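/- For all $\rho$ with $0 < \rho \le 1/2$ and all $\lambda$ with $0 < \lambda \le \rho/2$, one has $\max\{\mathrm{f}(\rho,\lambda), \mathrm{g}(\rho,\lambda), \mathrm{h}(\rho,\lambda)\} \le H(\rho) + \tfrac14$, where $\mathrm{f}(\rho,\lambda) = \frac{1}{2}H^*(2\lambda) + \frac{1}{2}H^*(2\rho-2\lambda)$, $\mathrm{g}(\rho,\lambda) = \frac{1}{8} + \frac{1}{2}H(\rho) + \frac{1}{4}H^*(2\rho - 2\lambda)$, and $\mathrm{h}(\rho,\lambda) = \frac{1}{2}H(\rho) + \frac{1}{4}$. -/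

import Mathlib

/-- The binary entropy function. -/
noncomputable def binH (x : ℝ) : ℝ :=
  -x * Real.logb 2 x - (1 - x) * Real.logb 2 (1 - x)

/-- `H^*(x) = H(x)` for `x ≤ 1/2`, and `H^*(x) = 1` for `x > 1/2`. -/
noncomputable def Hstar (x : ℝ) : ℝ := if x ≤ 1 / 2 then binH x else 1

theorem binH_eq_binEntropy_div (x : ℝ) : binH x = Real.binEntropy x / Real.log 2 := by
  simp only [binH, Real.binEntropy, Real.logb, Real.log_inv]
  ring

theorem binH_half : binH (1 / 2) = 1 := by
  rw [binH_eq_binEntropy_div, one_div, Real.binEntropy_two_inv]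
  exact div_self (Real.log_pos one_lt_two).ne'

theorem binH_nonneg {x : ℝ} (h0 : 0 ≤ x) (h1 : x ≤ 1) : 0 ≤ binH x := by
  rw [binH_eq_binEntropy_div]
  exact div_nonneg (Real.binEntropy_nonneg h0 h1) (Real.log_pos one_lt_two).le

theorem binH_le_binH {x y : ℝ} (h0 : 0 ≤ x) (hxy : x ≤ y) (hy : y ≤ 1 / 2) :
    binH x ≤ binH y := by
  simp only [binH_eq_binEntropy_div]
  refine div_le_div_of_nonneg_right ?_ (Real.log_pos one_lt_two).le
  exact Real.binEntropy_strictMonoOn.monotoneOn ⟨h0, by linarith⟩ ⟨by linarith, by linarith⟩ hxy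

/-- Midpoint concavity of the binary entropy. -/
theorem half_binH_add_half_binH_le {x y : ℝ} (hx0 : 0 ≤ x) (hx1 : x ≤ 1) (hy0 : 0 ≤ y)
    (hy1 : y ≤ 1) : binH x / 2 + binH y / 2 ≤ binH ((x + y) / 2) := by
  have hx : x ∈ Set.Icc (0 : ℝ) 1 := ⟨hx0, hx1⟩
  have hy : y ∈ Set.Icc (0 : ℝ) 1 := ⟨hy0, hy1⟩
  have hhalf : (0 : ℝ) ≤ 1 / 2 := by norm_num
  have h := Real.strictConcave_binEntropy.concaveOn.2 hx hy hhalf hhalf (add_halves 1)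
  simp only [smul_eq_mul] at h
  rw [show (1 / 2 : ℝ) * x + 1 / 2 * y = (x + y) / 2 by ring] at h
  have hdiv := div_le_div_of_nonneg_right h (Real.log_pos one_lt_two).le
  simp only [binH_eq_binEntropy_div]
  calc _ = (1 / 2 * Real.binEntropy x + 1 / 2 * Real.binEntropy y) / Real.log 2 := by ring
    _ ≤ _ := hdiv

/-- For `0 < ρ ≤ 1/2` and `0 < λ ≤ ρ/2`,
`max{f(ρ,λ), g(ρ,λ), h(ρ,λ)} ≤ H(ρ) + 1/4`, where
`f(ρ,λ) = H^*(2λ)/2 + H^*(2ρ-2λ)/2`, `g(ρ,λ) = 1/8 + H(ρ)/2 + H^*(2ρ-2λ)/4`,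
and `h(ρ,λ) = H(ρ)/2 + 1/4`. -/
theorem max_fgh_le (ρ lam : ℝ) (hρ0 : 0 < ρ) (hρ : ρ ≤ 1 / 2)
    (hlam0 : 0 < lam) (hlam : lam ≤ ρ / 2) :
    max (max (Hstar (2 * lam) / 2 + Hstar (2 * ρ - 2 * lam) / 2)
          (1 / 8 + binH ρ / 2 + Hstar (2 * ρ - 2 * lam) / 4))
        (binH ρ / 2 + 1 / 4) ≤ binH ρ + 1 / 4 := by
  have hρnn : 0 ≤ binH ρ := binH_nonneg hρ0.le (by linarith)
  have hsmall : Hstar (2 * lam) = binH (2 * lam) := if_pos (by linarith)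
  rw [hsmall]
  rcases le_or_gt (2 * ρ - 2 * lam) (1 / 2) with hle | hgt
  · have hbig : Hstar (2 * ρ - 2 * lam) = binH (2 * ρ - 2 * lam) := if_pos hle
    have hf := half_binH_add_half_binH_le (x := 2 * lam) (y := 2 * ρ - 2 * lam)
      (by linarith) (by linarith) (by linarith) (by linarith)
    rw [show (2 * lam + (2 * ρ - 2 * lam)) / 2 = ρ by ring] at hf
    have hlam_nn : 0 ≤ binH (2 * lam) := binH_nonneg (by linarith) (by linarith)
    rw [hbig]
    refine max_le (max_le ?_ ?_) ?_ <;> linarith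
  · have hbig : Hstar (2 * ρ - 2 * lam) = 1 := if_neg hgt.not_ge
    have hf := half_binH_add_half_binH_le (x := 2 * lam) (y := 1 / 2)
      (by linarith) (by linarith) (by norm_num) (by norm_num)
    have hmono : binH ((2 * lam + 1 / 2) / 2) ≤ binH ρ :=
      binH_le_binH (by linarith) (by linarith) hρ
    have hlam_nn : 0 ≤ binH (2 * lam) := binH_nonneg (by linarith) (by linarith)
    rw [binH_half] at hf
    rw [hbig]
    refine max_le (max_le ?_ ?_) ?_ <;> linarith
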